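/- arXiv:0912.0787 — 2 statements merged into one kernel-verified Lean document; each statement's English description precedes it below -/
import Mathlib

section
/- Let f : S^n → ℝ^n be a continuous map satisfying f(-x) = -f(x) for all x ∈ S^n. Then there exists x ∈ S^n with f(x) = 0. -/
namespace BU

variable {V : Type*}

/-- The sum of a mod 2 cochain over a chain. -/
def ev (F : List V → ZMod 2) (c : List (List V)) : ZMod 2 := (c.map F).sum

theorem ev_nil (F : List V → ZMod 2) : ev F [] = 0 := by simp [ev]
theorem ev_cons (F : List V → ZMod 2) (l c) : ev F (l :: c) = F l + ev F c := by simp [ev]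
theorem ev_append (F : List V → ZMod 2) (c d) : ev F (c ++ d) = ev F c + ev F d := by
  simp [ev]
theorem ev_map (F : List V → ZMod 2) (g : List V → List V) (c) :
    ev F (c.map g) = ev (fun l => F (g l)) c := by
  simp [ev, Function.comp_def]
theorem ev_add (F G : List V → ZMod 2) (c) : ev (fun l => F l + G l) c = ev F c + ev G c := by
  simp [ev]
theorem ev_mul (a : ZMod 2) (F : List V → ZMod 2) (c) : ev (fun l => a * F l) c = a * ev F c := by
  simp [ev, List.sum_map_mul_left]
theorem ev_zero (c) : ev (fun _ : List V => 0) c = 0 := by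
  simp [ev]
theorem ev_flatMap (F : List V → ZMod 2) (g : List V → List (List V)) (c) :
    ev F (c.flatMap g) = ev (fun l => ev F (g l)) c := by
  induction c with
  | nil => simp [ev]
  | cons a c ih => rw [List.flatMap_cons, ev_append, ev_cons, ih]
theorem ev_congr {F G : List V → ZMod 2} {c} (h : ∀ l ∈ c, F l = G l) : ev F c = ev G c := by
  unfold ev
  rw [List.map_congr_left h]

theorem add_self2 (a : ZMod 2) : a + a = 0 := CharTwo.add_self_eq_zero a

/-- Faces of a simplex. -/
def bd : List V → List (List V)
  | [] => []
  | v :: l => l :: (bd l).map (List.cons v)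

/-- Coboundary. -/
def cob (F : List V → ZMod 2) (l : List V) : ZMod 2 := ev F (bd l)

theorem cob_nil (F : List V → ZMod 2) : cob F [] = 0 := by simp [cob, bd, ev]
theorem cob_cons (F : List V → ZMod 2) (v l) :
    cob F (v :: l) = F l + cob (fun m => F (v :: m)) l := by
  simp [cob, bd, ev_cons, ev_map]
theorem cob_add (F G : List V → ZMod 2) (l) :
    cob (fun m => F m + G m) l = cob F l + cob G l := ev_add _ _ _
theorem cob_mul (a : ZMod 2) (F : List V → ZMod 2) (l) :
    cob (fun m => a * F m) l = a * cob F l := ev_mul _ _ _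
theorem cob_zero (l) : cob (fun _ : List V => 0) l = 0 := ev_zero _
theorem cob_map (F : List V → ZMod 2) (g : V → V) (l : List V) :
    cob F (l.map g) = cob (fun m => F (m.map g)) l := by
  induction l generalizing F with
  | nil => simp [cob_nil]
  | cons v l ih => simp [cob_cons, ih]

/-- Prism operator. -/
def prism (f g : V → V) : List V → List (List V)
  | [] => []
  | v :: l => (f v :: g v :: l.map g) :: (prism f g l).map (List.cons (f v))

theorem prism_homotopy (f g : V → V) (F : List V → ZMod 2) (l : List V) :
    ev (cob F) (prism f g l) + cob (fun m => ev F (prism f g m)) l =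
      F (l.map f) + F (l.map g) := by
  induction l generalizing F with
  | nil => simp [prism, ev_nil, cob_nil, add_self2]
  | cons v l ih =>
    have h := ih (fun m => F (f v :: m))
    simp only [prism, ev_cons, ev_map, cob_cons, cob_add, ev_add, List.map_cons, cob_map] at *
    have h1 := add_self2 (ev F (prism f g l))
    have h2 := add_self2 (cob (fun m => F (f v :: g v :: List.map g m)) l)
    have h3 := add_self2 (F (f v :: l.map g))
    linear_combination h + h1 + h2 + h3

theorem mem_prism {f g : V → V} {l m : List V} (hm : m ∈ prism f g l) :
    ∀ x ∈ m, ∃ y ∈ l, x = f y ∨ x = g y := by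
  induction l generalizing m with
  | nil => simp [prism] at hm
  | cons v l ih =>
    simp only [prism, List.mem_cons, List.mem_map] at hm
    rcases hm with rfl | ⟨m', hm', rfl⟩
    · intro x hx
      simp only [List.mem_cons, List.mem_map] at hx
      rcases hx with rfl | rfl | ⟨y, hy, rfl⟩
      · exact ⟨v, by simp, by simp⟩
      · exact ⟨v, by simp, by simp⟩
      · exact ⟨y, by simp [hy], by simp⟩
    · intro x hx
      simp only [List.mem_cons] at hx
      rcases hx with rfl | hx
      · exact ⟨v, by simp, by simp⟩
      · obtain ⟨y, hy, h⟩ := ih hm' x hx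
        exact ⟨y, by simp [hy], h⟩

/-- The product cocycle. -/
def W : List (V → ZMod 2) → List V → ZMod 2
  | [], [_] => 1
  | s :: ss, x :: y :: l => (s x + s y) * W ss (y :: l)
  | _, _ => 0

theorem W_nil (ss : List (V → ZMod 2)) : W ss [] = 0 := by cases ss <;> rfl

theorem cob_W (ss : List (V → ZMod 2)) (l : List V) : cob (W ss) l = 0 := by
  induction ss generalizing l with
  | nil =>
    match l with
    | [] => rfl
    | [x] => simp [cob_cons, cob_nil, W]
    | x :: y :: l =>
      simp only [cob_cons, W, cob_zero]
      cases l <;> simp [W, add_self2]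
  | cons s ss ih =>
    match l with
    | [] => rfl
    | [x] => simp [cob_cons, cob_nil, W]
    | x :: y :: l =>
      simp only [cob_cons, W, cob_mul]
      have h := ih (y :: l)
      rw [cob_cons] at h
      cases l with
      | nil => simp [W, cob_nil]
      | cons z l =>
        simp only [W]
        linear_combination (s x + s y) * h + (s z) * add_self2 (W ss (z :: l))

/-- The cochain whose coboundary is the product cocycle. -/
def A (s : V → ZMod 2) (ss : List (V → ZMod 2)) : List V → ZMod 2
  | [] => 0
  | x :: l => s x * W ss (x :: l)

theorem cob_A (s : V → ZMod 2) (ss : List (V → ZMod 2)) (l : List V) :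
    cob (A s ss) l = W (s :: ss) l := by
  match l with
  | [] => rfl
  | [x] => simp [cob_cons, cob_nil, W, A]
  | x :: y :: l =>
    have h := cob_W ss (x :: y :: l)
    simp only [cob_cons, A, W, cob_mul] at *
    linear_combination s x * h - s x * add_self2 (W ss (y :: l)) + s x * add_self2 (W ss (y :: l))
      - s x * add_self2 (W ss (y :: l))

theorem W_neg (T : V → V) (ss : List (V → ZMod 2)) (l : List V)
    (h : ∀ s ∈ ss, ∀ x ∈ l, s (T x) = s x + 1) : W ss (l.map T) = W ss l := by
  induction ss generalizing l with
  | nil =>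
    match l with
    | [] => rfl
    | [x] => rfl
    | x :: y :: l => rfl
  | cons s ss ih =>
    match l with
    | [] => rfl
    | [x] => rfl
    | x :: y :: l =>
      have := ih (y :: l) (fun s hs x hx => h s (by simp [hs]) x (by
        simp only [List.mem_cons] at hx ⊢; tauto))
      simp only [List.map_cons, W] at *
      rw [this, h s (by simp) x (by simp), h s (by simp) y (by simp)]
      linear_combination (W ss (y :: l)) * add_self2 1

theorem A_neg (T : V → V) (s : V → ZMod 2) (ss : List (V → ZMod 2)) (l : List V)
    (hs : ∀ x ∈ l, s (T x) = s x + 1)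
    (h : ∀ s ∈ ss, ∀ x ∈ l, s (T x) = s x + 1) :
    A s ss l + A s ss (l.map T) = W ss l := by
  cases l with
  | nil => simp [A, W_nil]
  | cons x l =>
    have := W_neg T ss (x :: l) h
    simp only [List.map_cons, A] at *
    rw [this, hs x (by simp)]
    linear_combination (s x) * add_self2 (W ss (x :: l))

theorem W_ne_zero (ss : List (V → ZMod 2)) (l : List V) (h : W ss l ≠ 0) :
    ∀ s ∈ ss, ∃ x ∈ l, ∃ y ∈ l, s x ≠ s y := by
  induction ss generalizing l with
  | nil => simp
  | cons s ss ih =>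
    match l with
    | [] => exact absurd rfl h
    | [x] => exact absurd rfl h
    | x :: y :: l =>
      simp only [W] at h
      intro s' hs'
      rcases List.mem_cons.1 hs' with rfl | hs'
      · refine ⟨x, by simp, y, by simp, fun e => ?_⟩
        rw [e, add_self2, zero_mul] at h
        exact h rfl
      · obtain ⟨a, ha, b, hb, hab⟩ := ih (y :: l) (right_ne_zero_of_mul h) s' hs'
        exact ⟨a, List.mem_cons_of_mem _ ha, b, List.mem_cons_of_mem _ hb, hab⟩

/-- A chain of small simplices in `K`. -/
def Good [PseudoMetricSpace V] (K : Set V) (ε : ℝ) (c : List (List V)) : Prop :=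
  ∀ l ∈ c, ∀ x ∈ l, x ∈ K ∧ ∀ y ∈ l, dist x y ≤ ε

section
variable {E : Type*} [NormedAddCommGroup E] [NormedSpace ℝ E]

/-- Symmetrized chain. -/
def sym (h : List (List E)) : List (List E) := h ++ h.map (List.map (fun x => -x))

theorem ev_sym (F : List E → ZMod 2) (h : List (List E)) :
    ev F (sym h) = ev F h + ev (fun l => F (l.map (fun x => -x))) h := by
  rw [sym, ev_append, ev_map]

theorem good_sym {K : Set E} (hK : ∀ x ∈ K, -x ∈ K) {ε : ℝ} {h : List (List E)}
    (hg : Good K ε h) : Good K ε (sym h) := by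
  intro l hl
  rcases List.mem_append.1 hl with hl | hl
  · exact hg l hl
  · obtain ⟨m, hm, rfl⟩ := List.mem_map.1 hl
    intro x hx
    obtain ⟨a, ha, rfl⟩ := List.mem_map.1 hx
    refine ⟨hK _ (hg m hm a ha).1, fun y hy => ?_⟩
    obtain ⟨b, hb, rfl⟩ := List.mem_map.1 hy
    rw [dist_neg_neg]
    exact (hg m hm a ha).2 b hb

theorem fill {K K' : Set E} {p : E} {C : ℝ} (hC : ∀ v ∈ K, dist v p ≤ C)
    (hp : p ∈ K')
    (hKK : ∀ v ∈ K, ∀ t : ℝ, 0 ≤ t → t ≤ 1 → AffineMap.lineMap v p t ∈ K')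
    {ε : ℝ} (hε : 0 < ε) (z : List (List E)) (hz : Good K (ε / 2) z)
    (hcyc : ∀ F, ev (cob F) z = 0) :
    ∃ h, Good K' ε h ∧ ∀ F, ev (cob F) h = ev F z := by
  obtain ⟨N, hN⟩ := exists_nat_gt (C / (ε / 2))
  obtain ⟨N, hN, hN0⟩ : ∃ N : ℕ, C / (ε / 2) < N ∧ 0 < N :=
    ⟨N + 1, by push_cast; linarith, by omega⟩
  have hN0' : (0 : ℝ) < N := by exact_mod_cast hN0
  set H : ℕ → E → E := fun j v => AffineMap.lineMap v p ((j : ℝ) / N) with hH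
  have hHK : ∀ j ≤ N, ∀ v ∈ K, H j v ∈ K' := fun j hj v hv =>
    hKK v hv _ (by positivity) (by rw [div_le_one hN0']; exact_mod_cast hj)
  have hlip : ∀ j ≤ N, ∀ v w, dist (H j v) (H j w) ≤ dist v w := by
    intro j hj v w
    have h1 : (j : ℝ) / N ≤ 1 := by rw [div_le_one hN0']; exact_mod_cast hj
    have h0 : 0 ≤ (j : ℝ) / N := by positivity
    have : H j v - H j w = (1 - (j : ℝ) / N) • (v - w) := by
      simp only [hH, AffineMap.lineMap_apply_module]
      module
    rw [dist_eq_norm, this, norm_smul, dist_eq_norm, Real.norm_of_nonneg (by linarith)]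
    nlinarith [norm_nonneg (v - w)]
  have hstep : ∀ j, ∀ v ∈ K, dist (H j v) (H (j+1) v) ≤ ε / 2 := by
    intro j v hv
    have : H j v - H (j+1) v = (1 / (N : ℝ)) • (v - p) := by
      simp only [hH, AffineMap.lineMap_apply_module]
      push_cast
      rw [add_div]
      module
    rw [dist_eq_norm, this, norm_smul, Real.norm_of_nonneg (by positivity), ← dist_eq_norm]
    have := hC v hv
    rw [div_lt_iff₀ (by positivity)] at hN
    rw [one_div, inv_mul_le_iff₀ hN0']
    linarith
  have key : ∀ j ≤ N, ∃ h, Good K' ε h ∧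
      ∀ F, ev (cob F) h = ev F z + ev (fun l => F (l.map (H j))) z := by
    intro j
    induction j with
    | zero =>
      intro _
      refine ⟨[], by simp [Good], fun F => ?_⟩
      have : H 0 = id := by ext v; simp [hH]
      simp [this, ev_nil, add_self2]
    | succ j ih =>
      intro hj
      obtain ⟨h, hg, hh⟩ := ih (by omega)
      refine ⟨h ++ z.flatMap (prism (H j) (H (j+1))), ?_, ?_⟩
      · intro l hl
        rcases List.mem_append.1 hl with hl | hl
        · exact hg l hl
        · obtain ⟨m, hm, hl⟩ := List.mem_flatMap.1 hl
          intro x hx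
          obtain ⟨a, ha, hxa⟩ := mem_prism hl x hx
          obtain ⟨haK, had⟩ := hz m hm a ha
          refine ⟨?_, fun y hy => ?_⟩
          · rcases hxa with rfl | rfl
            · exact hHK _ (by omega) _ haK
            · exact hHK _ hj _ haK
          · obtain ⟨b, hb, hyb⟩ := mem_prism hl y hy
            have hbK := (hz m hm b hb).1
            have hab := had b hb
            have l1 := hlip j (by omega) a b
            have l2 := hlip (j+1) hj a b
            have s1 := hstep j a haK
            have s2 := hstep j b hbK
            rcases hxa with rfl | rfl <;> rcases hyb with rfl | rfl
            · linarith
            · have := dist_triangle (H j a) (H j b) (H (j+1) b)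
              linarith
            · have := dist_triangle (H (j+1) a) (H j a) (H j b)
              rw [dist_comm (H (j+1) a) (H j a)] at this
              linarith
            · linarith
      · intro F
        rw [ev_append, hh, ev_flatMap]
        have h1 := hcyc (fun m => ev F (prism (H j) (H (j+1)) m))
        have h2 := ev_congr (c := z) (fun l _ => prism_homotopy (H j) (H (j+1)) F l)
        rw [ev_add, ev_add] at h2
        linear_combination h2 - h1 + add_self2 (ev (fun l => F (l.map (H j))) z)
  obtain ⟨h, hg, hh⟩ := key N le_rfl
  have hHN : ∀ v, H N v = p := by
    intro v
    simp [hH, div_self hN0'.ne']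
  refine ⟨h ++ z.map (fun l => p :: l.map (H N)), ?_, ?_⟩
  · intro l hl
    rcases List.mem_append.1 hl with hl | hl
    · exact hg l hl
    · obtain ⟨m, hm, rfl⟩ := List.mem_map.1 hl
      have hall : ∀ x ∈ p :: m.map (H N), x = p := by
        intro x hx
        rcases List.mem_cons.1 hx with rfl | hx
        · rfl
        · obtain ⟨y, _, rfl⟩ := List.mem_map.1 hx
          exact hHN y
      intro x hx
      rw [hall x hx]
      refine ⟨hp, fun y hy => ?_⟩
      rw [hall y hy, dist_self]
      exact hε.le
  · intro F
    rw [ev_append, hh, ev_map]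
    simp only [cob_cons, cob_map]
    rw [ev_add]
    have h1 := hcyc (fun m => F (p :: m.map (H N)))
    linear_combination h1 + add_self2 (ev (fun l => F (l.map (H N))) z)

end

/-- `k`-dimensional octahedral sphere. -/
def K (n k : ℕ) : Set (Fin (n+1) → ℝ) :=
  {x | (∀ j, k < j.1 → x j = 0) ∧ ∑ j, |x j| = 1}

theorem K_neg {n k : ℕ} : ∀ x ∈ K n k, -x ∈ K n k := by
  rintro x ⟨h1, h2⟩
  exact ⟨fun j hj => by simp [h1 j hj], by simpa using h2⟩

theorem K_norm {n k : ℕ} {x} (hx : x ∈ K n k) : ‖x‖ ≤ 1 := by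
  rw [pi_norm_le_iff_of_nonneg zero_le_one]
  intro i
  rw [← hx.2, Real.norm_eq_abs]
  exact Finset.single_le_sum (f := fun j => |x j|) (fun _ _ => abs_nonneg _) (Finset.mem_univ i)

theorem K_single {n k : ℕ} (hk : k < n + 1) :
    (Pi.single ⟨k, hk⟩ 1 : Fin (n+1) → ℝ) ∈ K n k := by
  refine ⟨fun j hj => ?_, ?_⟩
  · rw [Pi.single_eq_of_ne]
    rintro rfl
    exact lt_irrefl _ hj
  · rw [Finset.sum_eq_single ⟨k, hk⟩]
    · simp
    · intro b _ hb
      simp [Pi.single_eq_of_ne hb]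
    · simp

theorem K_line {n k : ℕ} (hk : k + 1 < n + 1) (v) (hv : v ∈ K n k) (t : ℝ) (h0 : 0 ≤ t)
    (h1 : t ≤ 1) :
    AffineMap.lineMap v (Pi.single ⟨k+1, hk⟩ 1 : Fin (n+1) → ℝ) t ∈ K n (k+1) := by
  have hs := K_single hk
  rw [AffineMap.lineMap_apply_module]
  refine ⟨fun j hj => ?_, ?_⟩
  · simp [hv.1 j (by omega), hs.1 j hj]
  · have : ∀ j, |((1 - t) • v + t • (Pi.single ⟨k+1, hk⟩ 1 : Fin (n+1) → ℝ)) j| =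
        (1 - t) * |v j| + t * |(Pi.single ⟨k+1, hk⟩ 1 : Fin (n+1) → ℝ) j| := by
      intro j
      by_cases hj : j = ⟨k+1, hk⟩
      · have : v j = 0 := hv.1 j (by rw [hj]; simp)
        simp [this, hj, abs_of_nonneg h0]
        subst hj
        simp [this, abs_of_nonneg h0]
      · simp [Pi.single_eq_of_ne hj, abs_mul, abs_of_nonneg (sub_nonneg.2 h1)]
    simp only [this]
    rw [Finset.sum_add_distrib, ← Finset.mul_sum, ← Finset.mul_sum, hv.2, hs.2]
    ring

theorem chains (n : ℕ) (k : ℕ) (hk : k < n + 1) (ε : ℝ) (hε : 0 < ε) :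
    ∃ h : List (List (Fin (n+1) → ℝ)), Good (K n k) ε h ∧ (∀ F, ev (cob F) (sym h) = 0) ∧
      ∀ ss : List ((Fin (n+1) → ℝ) → ZMod 2), ss.length = k →
        (∀ s ∈ ss, ∀ x, ∑ j, |x j| = 1 → s (-x) = s x + 1) → ev (W ss) h = 1 := by
  induction k generalizing ε with
  | zero =>
    refine ⟨[[Pi.single ⟨0, hk⟩ 1]], ?_, ?_, ?_⟩
    · intro l hl x hx
      simp only [List.mem_singleton] at hl
      subst hl
      simp only [List.mem_singleton] at hx
      subst hx
      refine ⟨K_single hk, fun y hy => ?_⟩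
      simp only [List.mem_singleton] at hy
      rw [hy, dist_self]
      exact hε.le
    · intro F
      simp [ev_sym, ev_cons, ev_nil, cob_cons, cob_nil, add_self2]
    · intro ss hss _
      rw [List.length_eq_zero_iff] at hss
      subst hss
      simp [ev_cons, ev_nil, W]
  | succ k ih =>
    obtain ⟨h, hg, hc, hW⟩ := ih (by omega) (ε / 2) (by positivity)
    obtain ⟨h', hg', hh'⟩ := fill (K := K n k) (K' := K n (k+1)) (p := Pi.single ⟨k+1, hk⟩ 1)
      (C := 2) (fun v hv => by
        rw [dist_eq_norm]
        have := norm_sub_le v (Pi.single ⟨k+1, hk⟩ 1 : Fin (n+1) → ℝ)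
        linarith [K_norm hv, K_norm (K_single hk)])
      (K_single hk) (K_line hk) hε (sym h) (good_sym K_neg hg) hc
    refine ⟨h', hg', ?_, ?_⟩
    · intro F
      rw [ev_sym]
      simp only [cob_map]
      rw [hh', hh', ev_sym, ev_sym]
      simp only [List.map_map, Function.comp_def, neg_neg, List.map_id_fun', id]
      linear_combination add_self2 (ev F h + ev (fun l => F (l.map (fun x => -x))) h)
    · intro ss hss hodd
      match ss, hss with
      | s :: ss, hss =>
        have h1 := hW ss (by simpa using hss) (fun s hs => hodd s (by simp [hs]))
        have h2 := hh' (A s ss)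
        rw [ev_congr (fun l _ => cob_A s ss l), ev_sym, ← ev_add] at h2
        rw [h2, ← h1]
        refine ev_congr fun l hl => A_neg _ s ss l ?_ ?_
        · exact fun x hx => hodd s (by simp) x (hg l hl x hx).1.2
        · exact fun s hs x hx => hodd s (by simp [hs]) x (hg l hl x hx).1.2

open Classical in
/-- Odd sign function of `g`. -/
noncomputable def sgn {n : ℕ} (g : (Fin (n+1) → ℝ) → ℝ) (x : Fin (n+1) → ℝ) : ZMod 2 :=
  if 0 < g x ∨ (g x = 0 ∧ WellOrderingRel (-x) x) then 1 else 0

theorem sgn_odd {n : ℕ} (g : (Fin (n+1) → ℝ) → ℝ) (x : Fin (n+1) → ℝ) (hx : x ≠ 0)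
    (hg : g (-x) = - g x) : sgn g (-x) = sgn g x + 1 := by
  have hne : -x ≠ x := fun h => hx (by
    have := self_eq_neg.1 h.symm
    exact this)
  have h01 : (0 : ZMod 2) = 1 + 1 := by decide
  have h1 : WellOrderingRel (-x) x ∨ WellOrderingRel x (-x) := by
    rcases trichotomous_of WellOrderingRel (-x) x with h | h | h
    · exact Or.inl h
    · exact absurd h hne
    · exact Or.inr h
  have h2 : WellOrderingRel (-x) x → ¬ WellOrderingRel x (-x) := fun h h' =>
    asymm_of WellOrderingRel h h'
  unfold sgn
  rw [hg, neg_neg]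
  rcases lt_trichotomy (g x) 0 with h | h | h
  · simp [h, h.le, h.ne, not_lt.2 h.le]
  · rcases h1 with h1 | h1
    · simp [h, h1, h2 h1, ← h01]
    · have : ¬ WellOrderingRel (-x) x := fun h' => h2 h' h1
      simp [h, h1, this]
  · simp [h, h.ne', not_lt.2 h.le, ← h01]

theorem octa (n : ℕ) (F : Fin n → (Fin (n+1) → ℝ) → ℝ)
    (hF : ∀ i, ContinuousOn (F i) {x | ∑ j, |x j| = 1})
    (hodd : ∀ i, ∀ x, ∑ j, |x j| = 1 → F i (-x) = - F i x) :
    ∃ x, ∑ j, |x j| = 1 ∧ ∀ i, F i x = 0 := by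
  set S : Set (Fin (n+1) → ℝ) := {x | ∑ j, |x j| = 1} with hS
  have hKS : K n n = S := by
    ext x
    simp only [K, hS, Set.mem_setOf_eq, and_iff_right_iff_imp]
    intro _ j hj
    omega
  have hcpt : IsCompact S := by
    refine Metric.isCompact_of_isClosed_isBounded ?_ ?_
    · exact isClosed_eq (by fun_prop) continuous_const
    · refine (Metric.isBounded_closedBall (x := (0 : Fin (n+1) → ℝ)) (r := 1)).subset ?_
      intro x hx
      rw [← hKS] at hx
      simpa using K_norm hx
  have hne : S.Nonempty := ⟨_, by rw [← hKS]; exact K_single (Nat.lt_succ_self n)⟩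
  obtain ⟨x0, hx0, hmin⟩ := hcpt.exists_isMinOn hne
    (f := fun x => ∑ i, |F i x|) (continuousOn_finset_sum _ fun i _ => (hF i).abs)
  by_contra hcon
  push Not at hcon
  obtain ⟨i0, hi0⟩ := hcon x0 hx0
  set m := ∑ i, |F i x0| with hm
  have hmpos : 0 < m := lt_of_lt_of_le (abs_pos.2 hi0)
    (Finset.single_le_sum (f := fun i => |F i x0|) (fun _ _ => abs_nonneg _) (Finset.mem_univ i0))
  set η := m / (n + 1) with hη
  have hηpos : 0 < η := by positivity
  have huc : ∀ i, ∃ δ > 0, ∀ x ∈ S, ∀ y ∈ S, dist x y < δ → dist (F i x) (F i y) < η := fun i => by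
    have := Metric.uniformContinuousOn_iff.1 (hcpt.uniformContinuousOn_of_continuous (hF i)) η hηpos
    exact this
  choose δ hδ hδF using huc
  obtain ⟨ε, hε, hεδ⟩ : ∃ ε > 0, ∀ i, ε < δ i := by
    have : Nonempty (Fin n) := ⟨i0⟩
    obtain ⟨i, hi⟩ := Finite.exists_min δ
    exact ⟨δ i / 2, half_pos (hδ i), fun j => by linarith [hi j, hδ i]⟩
  obtain ⟨h, hg, -, hW⟩ := chains n n (Nat.lt_succ_self n) ε hε
  have h1 := hW (List.ofFn fun i => sgn (F i)) (by simp) (by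
    intro s hs x hx
    obtain ⟨i, rfl⟩ := (List.mem_ofFn' _ _).1 hs
    refine sgn_odd _ _ ?_ (hodd i x hx)
    rintro rfl
    simp at hx)
  obtain ⟨l, hl, hWl⟩ : ∃ l ∈ h, W (List.ofFn fun i => sgn (F i)) l ≠ 0 := by
    by_contra hcon
    push Not at hcon
    rw [ev_congr hcon, ev_zero] at h1
    exact zero_ne_one h1
  cases l with
  | nil => exact hWl (W_nil _)
  | cons x l =>
    have hsmall : ∀ i, |F i x| < η := by
      intro i
      obtain ⟨a, ha, b, hb, hab⟩ := W_ne_zero _ _ hWl (sgn (F i))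
        ((List.mem_ofFn' _ _).2 ⟨i, rfl⟩)
      have hxg := hg _ hl x (by simp)
      have da := hδF i x (hKS ▸ hxg.1) a (hKS ▸ (hg _ hl a ha).1)
        ((hxg.2 a ha).trans_lt (hεδ i))
      have db := hδF i x (hKS ▸ hxg.1) b (hKS ▸ (hg _ hl b hb).1)
        ((hxg.2 b hb).trans_lt (hεδ i))
      rw [Real.dist_eq, abs_lt] at da db
      by_contra hcon
      push Not at hcon
      apply hab
      rcases le_abs.1 hcon with hc | hc
      · have ha' : 0 < F i a := by linarith
        have hb' : 0 < F i b := by linarith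
        simp [sgn, ha', hb']
      · have ha' : F i a < 0 := by linarith
        have hb' : F i b < 0 := by linarith
        simp [sgn, ha'.ne, hb'.ne, not_lt.2 ha'.le, not_lt.2 hb'.le]
    have hxS : x ∈ S := hKS ▸ (hg _ hl x (by simp)).1
    have hmx : m ≤ ∑ i, |F i x| := hmin hxS
    have : ∑ i, |F i x| ≤ ∑ _i : Fin n, η := Finset.sum_le_sum fun i _ => (hsmall i).le
    simp only [Finset.sum_const, Finset.card_univ, Fintype.card_fin, nsmul_eq_mul] at this
    have e : (n + 1) * η = m := by rw [hη]; field_simp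
    nlinarith

end BU

theorem stmt3 (n : ℕ) (f : EuclideanSpace ℝ (Fin (n + 1)) → EuclideanSpace ℝ (Fin n))
    (hf : ContinuousOn f (Metric.sphere 0 1))
    (hodd : ∀ x ∈ Metric.sphere (0 : EuclideanSpace ℝ (Fin (n + 1))) 1, f (-x) = -f x) :
    ∃ x ∈ Metric.sphere (0 : EuclideanSpace ℝ (Fin (n + 1))) 1, f x = 0 := by
  let g : (Fin (n+1) → ℝ) → EuclideanSpace ℝ (Fin (n+1)) := fun x =>
    ‖WithLp.toLp 2 x‖⁻¹ • WithLp.toLp 2 x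
  have hne : ∀ x : Fin (n+1) → ℝ, ∑ j, |x j| = 1 →
      (WithLp.toLp 2 x : EuclideanSpace ℝ (Fin (n+1))) ≠ 0 := by
    intro x hx h
    have : x = 0 := by simpa using h
    subst this
    simp at hx
  have hgS : ∀ x, ∑ j, |x j| = 1 → g x ∈ Metric.sphere (0 : EuclideanSpace ℝ (Fin (n+1))) 1 := by
    intro x hx
    have := norm_ne_zero_iff.2 (hne x hx)
    simp only [g, mem_sphere_zero_iff_norm, norm_smul, norm_inv, norm_norm]
    exact inv_mul_cancel₀ this
  have hgc : ContinuousOn g {x | ∑ j, |x j| = 1} := by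
    have hc : Continuous fun x : Fin (n+1) → ℝ =>
        (WithLp.toLp 2 x : EuclideanSpace ℝ (Fin (n+1))) := PiLp.continuous_toLp 2 _
    exact (hc.norm.continuousOn.inv₀ fun x hx => norm_ne_zero_iff.2 (hne x hx)).smul
      hc.continuousOn
  have hgn : ∀ x, g (-x) = - g x := by
    intro x
    simp [g]
  obtain ⟨x, hx, hx0⟩ := BU.octa n (fun i x => f (g x) i)
    (fun i => by
      have h1 : ContinuousOn (fun x => f (g x)) {x | ∑ j, |x j| = 1} := hf.comp hgc hgS
      have h2 : Continuous fun y : EuclideanSpace ℝ (Fin n) => y i := by fun_prop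
      exact h2.comp_continuousOn h1)
    (fun i x hx => by
      show f (g (-x)) i = - f (g x) i
      rw [hgn, hodd _ (hgS x hx)]
      simp)
  exact ⟨g x, hgS x hx, by ext i; simpa using hx0 i⟩
end

section
/- Let F₁,…,F_{n+1} be closed sets covering S^n. Then there exists an index i and a point x ∈ S^n with x ∈ F_i and -x ∈ F_i. -/
namespace LS
open Finsupp

/-- Chains mod 2 on ordered tuples. -/
abbrev Ch (E : Type*) := List E →₀ ZMod 2

noncomputable section
variable {E : Type*}

/-- basis extension -/
def ext {M : Type*} [AddCommGroup M] [Module (ZMod 2) M] (f : List E → M) : Ch E →ₗ[ZMod 2] M :=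
  Finsupp.linearCombination (ZMod 2) f

@[simp] lemma ext_single {M : Type*} [AddCommGroup M] [Module (ZMod 2) M] (f : List E → M)
    (l : List E) : ext f (single l 1) = f l := by simp [ext]

lemma hom_ext {M : Type*} [AddCommGroup M] [Module (ZMod 2) M] {f g : Ch E →ₗ[ZMod 2] M}
    (h : ∀ l, f (single l 1) = g (single l 1)) (c : Ch E) : f c = g c := by
  have : f = g := by
    apply Finsupp.lhom_ext'
    intro l
    apply LinearMap.ext_ring
    simpa using h l
  rw [this]

lemma add_self_zero {M : Type*} [AddCommGroup M] [Module (ZMod 2) M] (x : M) : x + x = 0 :=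
  ZModModule.add_self x

/-- cone -/
def cone (v : E) : Ch E →ₗ[ZMod 2] Ch E := ext fun l => single (v :: l) 1

/-- boundary on lists -/
def bdL : List E → Ch E
  | [] => 0
  | v :: l => single l 1 + cone v (bdL l)

/-- boundary -/
def bd : Ch E →ₗ[ZMod 2] Ch E := ext bdL

/-- functoriality -/
def mp (f : E → E) : Ch E →ₗ[ZMod 2] Ch E := ext fun l => single (l.map f) 1

/-- prism on lists -/
def prL (f g : E → E) : List E → Ch E
  | [] => 0
  | v :: l => single (f v :: g v :: l.map g) 1 + cone (f v) (prL f g l)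

/-- prism -/
def pr (f g : E → E) : Ch E →ₗ[ZMod 2] Ch E := ext (prL f g)

lemma cone_single (v : E) (l : List E) : cone v (single l 1) = single (v :: l) 1 := by simp [cone]
lemma mp_single (f : E → E) (l : List E) : mp f (single l 1) = single (l.map f) 1 := by simp [mp]
lemma bd_nil : bd (single ([] : List E) 1) = 0 := by simp [bd, bdL]
lemma bd_cons (v : E) (l : List E) :
    bd (single (v :: l) 1) = single l 1 + cone v (bd (single l 1)) := by simp [bd, bdL]
lemma pr_nil (f g : E → E) : pr f g (single ([] : List E) 1) = 0 := by simp [pr, prL]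
lemma pr_cons (f g : E → E) (v : E) (l : List E) :
    pr f g (single (v :: l) 1) =
      single (f v :: g v :: l.map g) 1 + cone (f v) (pr f g (single l 1)) := by simp [pr, prL]

lemma bd_cone (v : E) (c : Ch E) : bd (cone v c) = c + cone v (bd c) := by
  refine hom_ext (f := bd ∘ₗ cone v) (g := LinearMap.id + cone v ∘ₗ bd) (fun l => ?_) c
  simp [cone_single, bd_cons]

lemma bd_bd (c : Ch E) : bd (bd c) = 0 := by
  refine hom_ext (f := bd ∘ₗ bd) (g := 0) (fun l => ?_) c
  simp only [LinearMap.comp_apply, LinearMap.zero_apply]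
  induction l with
  | nil => simp [bd_nil]
  | cons v l ih => rw [bd_cons, map_add, bd_cone, ih, map_zero, add_zero, add_self_zero]

lemma mp_cone (f : E → E) (v : E) (c : Ch E) : mp f (cone v c) = cone (f v) (mp f c) := by
  refine hom_ext (f := mp f ∘ₗ cone v) (g := cone (f v) ∘ₗ mp f) (fun l => ?_) c
  simp [cone_single, mp_single]

lemma bd_mp (f : E → E) (c : Ch E) : bd (mp f c) = mp f (bd c) := by
  refine hom_ext (f := bd ∘ₗ mp f) (g := mp f ∘ₗ bd) (fun l => ?_) c
  simp only [LinearMap.comp_apply]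
  induction l with
  | nil => simp [bd_nil, mp_single]
  | cons v l ih =>
    rw [mp_single] at ih
    rw [mp_single, List.map_cons, bd_cons, bd_cons, map_add, mp_cone, ih, mp_single]

lemma mp_mp (f g : E → E) (c : Ch E) : mp f (mp g c) = mp (f ∘ g) c := by
  refine hom_ext (f := mp f ∘ₗ mp g) (g := mp (f ∘ g)) (fun l => ?_) c
  simp [mp_single]

lemma mp_id (c : Ch E) : mp id c = c := by
  refine hom_ext (f := mp id) (g := LinearMap.id) (fun l => ?_) c
  simp [mp_single]

lemma pr_cone (f g : E → E) (v : E) (c : Ch E) :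
    pr f g (cone v c) = cone (f v) (cone (g v) (mp g c)) + cone (f v) (pr f g c) := by
  refine hom_ext (f := pr f g ∘ₗ cone v)
    (g := cone (f v) ∘ₗ cone (g v) ∘ₗ mp g + cone (f v) ∘ₗ pr f g) (fun l => ?_) c
  simp [cone_single, mp_single, pr_cons]

lemma bd_pr (f g : E → E) (c : Ch E) :
    bd (pr f g c) = pr f g (bd c) + (mp g c + mp f c) := by
  refine hom_ext (f := bd ∘ₗ pr f g) (g := pr f g ∘ₗ bd + (mp g + mp f)) (fun l => ?_) c
  simp only [LinearMap.comp_apply, LinearMap.add_apply]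
  induction l with
  | nil => simp [bd_nil, pr_nil, mp_single, add_self_zero]
  | cons v l ih =>
    have h1 := bd_mp g (single l 1)
    rw [mp_single] at h1
    rw [pr_cons, map_add, bd_cone, ih, bd_cons, bd_cons, bd_cons, h1, map_add (pr f g), pr_cone]
    simp only [map_add, mp_single, cone_single, List.map_cons]
    have h2 := add_self_zero (single (f v :: l.map g) 1 : Ch E)
    linear_combination (norm := abel) h2

/-- total homotopy -/
def tot (h : ℕ → E → E) (N : ℕ) : Ch E →ₗ[ZMod 2] Ch E :=
  ∑ j ∈ Finset.range N, pr (h j) (h (j + 1))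

lemma bd_tot (h : ℕ → E → E) (N : ℕ) (c : Ch E) :
    bd (tot h N c) = tot h N (bd c) + (mp (h N) c + mp (h 0) c) := by
  induction N with
  | zero => simp [tot, add_self_zero]
  | succ N ih =>
    simp only [tot, Finset.sum_range_succ, LinearMap.add_apply, map_add] at ih ⊢
    rw [ih, bd_pr]
    have h2 := add_self_zero (mp (h N) c)
    linear_combination (norm := abel) h2

/-- support predicate -/
def Sup (P : List E → Prop) (c : Ch E) : Prop := ∀ l ∈ c.support, P l

lemma Sup.add {P : List E → Prop} {c d : Ch E} (hc : Sup P c) (hd : Sup P d) : Sup P (c + d) := by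
  classical
  intro l hl
  rcases Finset.mem_union.1 (Finsupp.support_add hl) with h | h
  · exact hc l h
  · exact hd l h

lemma Sup.zero {P : List E → Prop} : Sup P (0 : Ch E) := by intro l hl; simp at hl

lemma Sup.single {P : List E → Prop} {l : List E} (h : P l) : Sup P (Finsupp.single l 1) := by
  intro m hm
  have := Finsupp.support_single_subset hm
  simp at this
  exact this ▸ h

lemma Sup.sum {P : List E → Prop} {ι : Type*} (s : Finset ι) (f : ι → Ch E)
    (h : ∀ i ∈ s, Sup P (f i)) : Sup P (∑ i ∈ s, f i) := by
  classical
  induction s using Finset.induction_on with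
  | empty => simpa using Sup.zero
  | insert a s ha ih =>
    rw [Finset.sum_insert ha]
    exact (h a (by simp)).add (ih fun i hi => h i (by simp [hi]))

lemma Sup.map {P Q : List E → Prop} {f : Ch E →ₗ[ZMod 2] Ch E} {c : Ch E} (hc : Sup P c)
    (hf : ∀ l, P l → Sup Q (f (Finsupp.single l 1))) : Sup Q (f c) := by
  rw [← Finsupp.sum_single c, Finsupp.sum, map_sum]
  apply Sup.sum
  intro l hl
  have : c l = 1 := by
    have h0 := Finsupp.mem_support_iff.1 hl
    generalize c l = a at h0
    revert a; decide
  rw [this]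
  exact hf l (hc l hl)

lemma Sup.mono {P Q : List E → Prop} {c : Ch E} (hc : Sup P c) (h : ∀ l, P l → Q l) : Sup Q c :=
  fun l hl => h l (hc l hl)

lemma sup_pr (f g : E → E) (l : List E) :
    Sup (fun m => ∀ x ∈ m, ∃ v ∈ l, x = f v ∨ x = g v) (pr f g (single l 1)) := by
  induction l with
  | nil => rw [pr_nil]; exact Sup.zero
  | cons v l ih =>
    rw [pr_cons]
    refine Sup.add (Sup.single ?_) (Sup.map ih ?_)
    · intro x hx
      simp only [List.mem_cons, List.mem_map] at hx
      rcases hx with rfl | rfl | ⟨y, hy, rfl⟩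
      · exact ⟨v, by simp, Or.inl rfl⟩
      · exact ⟨v, by simp, Or.inr rfl⟩
      · exact ⟨y, by simp [hy], Or.inr rfl⟩
    · intro m hm
      rw [cone_single]
      refine Sup.single ?_
      intro x hx
      rcases List.mem_cons.1 hx with rfl | hx
      · exact ⟨v, by simp, Or.inl rfl⟩
      · obtain ⟨y, hy, h⟩ := hm x hx
        exact ⟨y, by simp [hy], h⟩

lemma fun_eq {P : List E → Prop} {f g : Ch E →ₗ[ZMod 2] ZMod 2} {c : Ch E} (hc : Sup P c)
    (h : ∀ l, P l → f (single l 1) = g (single l 1)) : f c = g c := by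
  rw [← Finsupp.sum_single c, Finsupp.sum, map_sum, map_sum]
  refine Finset.sum_congr rfl fun l hl => ?_
  have : c l = 1 := by
    have h0 := Finsupp.mem_support_iff.1 hl
    generalize c l = a at h0
    revert a; decide
  rw [this]
  exact h l (hc l hl)

/-- head value -/
def hd (s : E → ZMod 2) : List E → ZMod 2
  | [] => 0
  | v :: _ => s v

/-- multiply a cochain by the head value -/
def mulhd (s : E → ZMod 2) (W : Ch E →ₗ[ZMod 2] ZMod 2) : Ch E →ₗ[ZMod 2] ZMod 2 :=
  ext fun l => hd s l * W (single l 1)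

/-- cup product cocycles -/
def W (s : ℕ → E → ZMod 2) : ℕ → (Ch E →ₗ[ZMod 2] ZMod 2)
  | 0 => ext fun l => if l.length = 1 then 1 else 0
  | k + 1 => mulhd (s k) (W s k) ∘ₗ bd

lemma mulhd_single (s : E → ZMod 2) (w : Ch E →ₗ[ZMod 2] ZMod 2) (l : List E) :
    mulhd s w (single l 1) = hd s l * w (single l 1) := by simp [mulhd]

lemma mulhd_cone (s : E → ZMod 2) (w : Ch E →ₗ[ZMod 2] ZMod 2) (v : E) (c : Ch E) :
    mulhd s w (cone v c) = s v * w (cone v c) := by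
  refine hom_ext (f := mulhd s w ∘ₗ cone v) (g := s v • (w ∘ₗ cone v)) (fun l => ?_) c
  simp [cone_single, mulhd_single, hd]

lemma W_bd (s : ℕ → E → ZMod 2) (k : ℕ) (c : Ch E) : W s k (bd c) = 0 := by
  cases k with
  | succ k => simp [W, bd_bd]
  | zero =>
    refine hom_ext (f := W s 0 ∘ₗ bd) (g := 0) (fun l => ?_) c
    simp only [LinearMap.comp_apply, LinearMap.zero_apply]
    rcases l with _ | ⟨a, _ | ⟨b, l⟩⟩
    · simp [bd_nil]
    · simp [bd_cons, bd_nil, W]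
    · rw [bd_cons, bd_cons]
      simp only [map_add, cone_single]
      have h : ∀ d : Ch E, W s 0 (cone a (cone b d)) = 0 := by
        intro d
        refine hom_ext (f := W s 0 ∘ₗ cone a ∘ₗ cone b) (g := 0) (fun l => ?_) d
        simp [cone_single, W]
      rw [h]
      simp [W, add_self_zero]

lemma W_nil (s : ℕ → E → ZMod 2) (k : ℕ) : W s k (single [] 1) = 0 := by
  cases k <;> simp [W, bd_nil]

lemma W_cons (s : ℕ → E → ZMod 2) (k : ℕ) (v : E) (m : List E) :
    W s (k + 1) (single (v :: m) 1) = (hd (s k) m + s k v) * W s k (single m 1) := by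
  have h := W_bd s k (single (v :: m) 1)
  rw [bd_cons, map_add] at h
  have h2 : W s k (cone v (bd (single m 1))) = W s k (single m 1) := by
    have h3 := add_self_zero (W s k (single m 1))
    linear_combination h - h3
  simp only [W, LinearMap.comp_apply]
  rw [bd_cons, map_add, mulhd_single, mulhd_cone, h2]
  ring

lemma W_vanish (s : ℕ → E → ZMod 2) (j : ℕ) (k : ℕ) (hjk : j < k) (l : List E)
    (h : ∀ x ∈ l, ∀ y ∈ l, s j x = s j y) : W s k (single l 1) = 0 := by
  induction k generalizing l with
  | zero => omega
  | succ k ih =>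
    rcases l with _ | ⟨v, _ | ⟨w, m⟩⟩
    · exact W_nil s _
    · rw [W_cons, W_nil, mul_zero]
    · rw [W_cons]
      rcases Nat.lt_succ_iff_lt_or_eq.1 hjk with h1 | rfl
      · rw [ih h1 _ (fun x hx y hy => h x (by simp [hx]) y (by simp [hy])), mul_zero]
      · have := h v (by simp) w (by simp)
        simp [hd, this, add_self_zero]

variable [AddCommGroup E]

lemma W_neg (s : ℕ → E → ZMod 2) (p : E → Prop) (hs : ∀ i x, p x → s i (-x) = s i x + 1)
    (k : ℕ) (l : List E) (hl : ∀ x ∈ l, p x) :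
    W s k (single (l.map (fun x => -x)) 1) = W s k (single l 1) := by
  induction k generalizing l with
  | zero => simp [W]
  | succ k ih =>
    rcases l with _ | ⟨v, _ | ⟨w, m⟩⟩
    · simp
    · simp only [List.map_cons, List.map_nil, W_cons, W_nil, mul_zero]
    · rw [List.map_cons, W_cons, W_cons, ih _ (fun x hx => hl x (by simp [hx]))]
      simp only [hd, List.map_cons]
      rw [hs k v (hl v (by simp)), hs k w (hl w (by simp))]
      have := add_self_zero (1 : ZMod 2)
      linear_combination (W s k (single (w :: m) 1)) * this

lemma step (s : ℕ → E → ZMod 2) (p : E → Prop) (hs : ∀ i x, p x → s i (-x) = s i x + 1)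
    (k : ℕ) (z z' : Ch E) (hz : Sup (fun l => ∀ x ∈ l, p x) z)
    (hb : bd z' = z + mp (fun x => -x) z) : W s (k + 1) z' = W s k z := by
  simp only [W, LinearMap.comp_apply]
  rw [hb]
  refine fun_eq (f := mulhd (s k) (W s k) ∘ₗ (LinearMap.id + mp (fun x => -x))) hz ?_
  intro l hl
  simp only [LinearMap.comp_apply, LinearMap.add_apply, LinearMap.id_apply, map_add, mp_single,
    mulhd_single]
  rw [W_neg s p hs k l hl]
  rcases l with _ | ⟨v, l⟩
  · simp [W_nil]
  · simp only [hd, List.map_cons]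
    rw [hs k v (hl v (by simp))]
    have := add_self_zero (s k v)
    linear_combination (W s k (single (v :: l) 1)) * this

lemma exists_step (h : ℕ → E → E) (N : ℕ) (h0 : h 0 = id) (p : E) (hN : ∀ x, h N x = p)
    (z : Ch E) (hz : bd (z + mp (fun x => -x) z) = 0) :
    bd (tot h N (z + mp (fun x => -x) z)) = z + mp (fun x => -x) z := by
  rw [bd_tot, hz, h0, mp_id, map_zero, zero_add, map_add, mp_mp]
  have : h N ∘ (fun x => -x) = h N := by funext x; simp [hN]
  rw [this, add_self_zero, zero_add]

lemma cyc (z z' : Ch E) (hb : bd z' = z + mp (fun x => -x) z) :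
    bd (z' + mp (fun x => -x) z') = 0 := by
  rw [map_add, bd_mp, hb, map_add, mp_mp]
  have : ((fun x : E => -x) ∘ fun x => -x) = id := by funext x; simp
  rw [this, mp_id]
  have h1 := add_self_zero z
  have h2 := add_self_zero (mp (fun x => -x) z)
  linear_combination (norm := abel) h1 + h2

end

noncomputable section
variable {n : ℕ}

/-- Euclidean space -/
abbrev V (n : ℕ) := EuclideanSpace ℝ (Fin (n + 1))

/-- smallness -/
def Good (k : ℕ) (d : ℝ) (l : List (V n)) : Prop :=
  (∀ x ∈ l, ‖x‖ = 1 ∧ ∀ i : Fin (n + 1), k < i.val → x i = 0) ∧ ∀ x ∈ l, ∀ y ∈ l, dist x y ≤ d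

/-- rotation -/
def rot (e : V n) (t : ℝ) (x : V n) : V n := Real.cos t • x + Real.sin t • e

lemma rot_norm (e x : V n) (t : ℝ) (he : ‖e‖ = 1) (hx : ‖x‖ = 1) (hex : inner ℝ x e = 0) :
    ‖rot e t x‖ = 1 := by
  have : ‖rot e t x‖ ^ 2 = 1 := by
    rw [rot, norm_add_sq_real, norm_smul, norm_smul, inner_smul_left, inner_smul_right, hex, he, hx]
    simp
  nlinarith [norm_nonneg (rot e t x)]

lemma rot_dist (e x y : V n) (t : ℝ) : dist (rot e t x) (rot e t y) ≤ dist x y := by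
  have : rot e t x - rot e t y = Real.cos t • (x - y) := by simp only [rot]; module
  rw [dist_eq_norm, this, norm_smul, dist_eq_norm]
  have := Real.abs_cos_le_one t
  rw [Real.norm_eq_abs]
  nlinarith [norm_nonneg (x - y)]

lemma rot_dist' (e x : V n) (t u : ℝ) (he : ‖e‖ = 1) (hx : ‖x‖ = 1) :
    dist (rot e t x) (rot e u x) ≤ 2 * |t - u| := by
  have : rot e t x - rot e u x =
    (Real.cos t - Real.cos u) • x + (Real.sin t - Real.sin u) • e := by simp only [rot]; module
  rw [dist_eq_norm, this]
  refine (norm_add_le _ _).trans ?_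
  rw [norm_smul, norm_smul, he, hx, Real.norm_eq_abs, Real.norm_eq_abs]
  have h1 : |Real.cos t - Real.cos u| ≤ |t - u| := by
    simpa [dist_eq_norm] using Real.lipschitzWith_cos.dist_le_mul t u
  have h2 : |Real.sin t - Real.sin u| ≤ |t - u| := by
    simpa [dist_eq_norm] using Real.lipschitzWith_sin.dist_le_mul t u
  linarith

lemma exists_chain (s : ℕ → V n → ZMod 2) (hs : ∀ i x, ‖x‖ = 1 → s i (-x) = s i x + 1)
    (N : ℕ) (hN : 0 < N) (k : ℕ) (hk : k ≤ n) :
    ∃ z : Ch (V n), Sup (Good k (k * (Real.pi / N))) z ∧ bd (z + mp (fun x => -x) z) = 0 ∧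
      W s k z = 1 := by
  induction k with
  | zero =>
    refine ⟨single [EuclideanSpace.single 0 1] 1, Sup.single ⟨?_, ?_⟩, ?_, ?_⟩
    · intro x hx
      simp only [List.mem_singleton] at hx
      subst hx
      refine ⟨by simp, fun i hi => ?_⟩
      have : i ≠ 0 := by rintro rfl; simp at hi
      simp [this]
    · intro x hx y hy
      simp only [List.mem_singleton] at hx hy
      subst hx hy
      simp
    · rw [mp_single, List.map_cons, List.map_nil, map_add, bd_cons, bd_cons, bd_nil]
      simp [add_self_zero]
    · simp [W]
  | succ k ih =>
    obtain ⟨z, hz, hc, hw⟩ := ih (by omega)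
    set e : V n := EuclideanSpace.single ⟨k + 1, by omega⟩ 1 with he
    have he1 : ‖e‖ = 1 := by simp [he]
    have hNr : (0 : ℝ) < N := by exact_mod_cast hN
    set h : ℕ → V n → V n := fun j => rot e (j * (Real.pi / 2 / N)) with hh
    have h0 : h 0 = id := by funext x; simp [hh, rot]
    have hNe : ∀ x, h N x = e := by
      intro x
      have : (N : ℝ) * (Real.pi / 2 / N) = Real.pi / 2 := by field_simp
      simp only [hh, rot, this]
      simp
    have hb := exists_step h N h0 e hNe z hc
    refine ⟨tot h N (z + mp (fun x => -x) z), ?_, cyc _ _ hb, ?_⟩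
    · have hz2 : Sup (Good k (k * (Real.pi / N))) (z + mp (fun x => -x) z) := by
        refine hz.add (hz.map fun l hl => ?_)
        rw [mp_single]
        refine Sup.single ⟨?_, ?_⟩
        · intro x hx
          obtain ⟨y, hy, rfl⟩ := List.mem_map.1 hx
          refine ⟨by simpa using (hl.1 y hy).1, fun i hi => by simpa using (hl.1 y hy).2 i hi⟩
        · intro x hx x' hx'
          obtain ⟨y, hy, rfl⟩ := List.mem_map.1 hx
          obtain ⟨y', hy', rfl⟩ := List.mem_map.1 hx'
          simpa using hl.2 y hy y' hy'
      refine hz2.map fun l hl => ?_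
      rw [tot, LinearMap.sum_apply]
      refine Sup.sum _ _ fun j _ => (sup_pr _ _ l).mono fun m hm => ?_
      have key : ∀ x ∈ m, ∃ v ∈ l, ∃ t : ℝ, x = rot e t v ∧
          (t = j * (Real.pi / 2 / N) ∨ t = (j + 1) * (Real.pi / 2 / N)) := by
        intro x hx
        obtain ⟨v, hv, h1 | h1⟩ := hm x hx
        · exact ⟨v, hv, _, h1, Or.inl rfl⟩
        · refine ⟨v, hv, _, h1, Or.inr (by push_cast; rfl)⟩
      refine ⟨?_, ?_⟩
      · intro x hx
        obtain ⟨v, hv, t, rfl, -⟩ := key x hx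
        refine ⟨rot_norm e v t he1 (hl.1 v hv).1 ?_, fun i hi => ?_⟩
        · have := (hl.1 v hv).2 ⟨k + 1, by omega⟩ (by simp)
          simp [he, EuclideanSpace.inner_single_right, this]
        · have h1 := (hl.1 v hv).2 i (by omega)
          have h2 : i ≠ ⟨k + 1, by omega⟩ := by intro h; rw [h] at hi; simp at hi
          simp [rot, he, h1, h2]
      · intro x hx y hy
        obtain ⟨v, hv, t, rfl, ht⟩ := key x hx
        obtain ⟨w, hw, u, rfl, hu⟩ := key y hy
        have h1 := rot_dist e v w t
        have h2 := rot_dist' e w t u he1 (hl.1 w hw).1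
        have h3 := hl.2 v hv w hw
        have h4 := dist_triangle (rot e t v) (rot e t w) (rot e u w)
        have h6 : 0 ≤ Real.pi / 2 / N := by positivity
        have h5 : |t - u| ≤ Real.pi / 2 / N := by
          rw [abs_le]
          rcases ht with rfl | rfl <;> rcases hu with rfl | rfl <;> constructor <;> nlinarith
        have h7 : Real.pi / N = 2 * (Real.pi / 2 / N) := by ring
        push_cast
        rw [h7] at h3 ⊢
        linarith
    · rw [step s (fun x => ‖x‖ = 1) hs k z _ (hz.mono fun l hl x hx => (hl.1 x hx).1) hb, hw]

open Classical in
/-- the sign cochain of a closed set -/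
def sgn (δ : ℝ) (K : Set (V n)) (x : V n) : ZMod 2 :=
  if x ∈ Metric.thickening δ K then 1 else if -x ∈ Metric.thickening δ K then 0 else
    if WellOrderingRel x (-x) then 1 else 0

open Classical in
lemma sgn_neg (δ : ℝ) (K : Set (V n)) (x : V n) (hx : ‖x‖ = 1)
    (hK : ¬ (x ∈ Metric.thickening δ K ∧ -x ∈ Metric.thickening δ K)) :
    sgn δ K (-x) = sgn δ K x + 1 := by
  have h2 : (0 : ZMod 2) = 1 + 1 := by decide
  have hne : x ≠ -x := by
    intro h
    have h3 : (2 : ℝ) • x = 0 := by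
      rw [two_smul]
      calc x + x = x + -x := congrArg (fun y => x + y) h
        _ = 0 := add_neg_cancel x
    have : x = 0 := (smul_eq_zero.1 h3).resolve_left two_ne_zero
    simp [this] at hx
  have e1 : sgn δ K (-x) = if -x ∈ Metric.thickening δ K then 1 else
      if x ∈ Metric.thickening δ K then 0 else if WellOrderingRel (-x) x then 1 else 0 := by
    have hnn : - -x = x := neg_neg x
    rw [sgn, hnn]
  rw [e1, sgn]
  by_cases h1 : x ∈ Metric.thickening δ K
  · have h3 : -x ∉ Metric.thickening δ K := fun h => hK ⟨h1, h⟩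
    simp [h1, h3, h2]
  · by_cases h3 : -x ∈ Metric.thickening δ K
    · simp [h1, h3]
    · rcases trichotomous_of WellOrderingRel x (-x) with h | h | h
      · have h' : ¬ WellOrderingRel (-x) x := fun h4 => asymm_of WellOrderingRel h h4
        simp [h1, h3, h, h', h2]
      · exact absurd h hne
      · have h' : ¬ WellOrderingRel x (-x) := fun h4 => asymm_of WellOrderingRel h h4
        simp [h1, h3, h, h']

lemma exists_delta (K : Set (V n)) (hK : IsCompact K) (hd : ∀ x ∈ K, -x ∉ K) :
    ∃ δ > 0, ∀ x, ¬ (x ∈ Metric.thickening δ K ∧ -x ∈ Metric.thickening δ K) := by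
  have hdis : Disjoint K ((fun x => -x) '' K) := by
    rw [Set.disjoint_left]
    rintro x hx ⟨y, hy, rfl⟩
    exact hd y hy hx
  obtain ⟨δ, hδ, h⟩ := hdis.exists_thickenings hK (hK.image continuous_neg).isClosed
  refine ⟨δ, hδ, fun x ⟨h1, h2⟩ => Set.disjoint_left.1 h h1 ?_⟩
  rw [Metric.mem_thickening_iff] at h2 ⊢
  obtain ⟨y, hy, hxy⟩ := h2
  refine ⟨-y, ⟨y, hy, rfl⟩, ?_⟩
  rwa [← dist_neg_neg, neg_neg]

end
end LS

theorem stmt11 (n : ℕ) (F : Fin (n + 1) → Set (EuclideanSpace ℝ (Fin (n + 1))))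
    (hF : ∀ i, IsClosed (F i))
    (hcover : Metric.sphere (0 : EuclideanSpace ℝ (Fin (n + 1))) 1 ⊆ ⋃ i, F i) :
    ∃ i, ∃ x ∈ Metric.sphere (0 : EuclideanSpace ℝ (Fin (n + 1))) 1,
      x ∈ F i ∧ -x ∈ F i := by
  by_contra hcon
  push Not at hcon
  set S := Metric.sphere (0 : EuclideanSpace ℝ (Fin (n + 1))) 1 with hS
  have hd : ∀ i, ∃ δ > 0, ∀ x, ¬ (x ∈ Metric.thickening δ (F i ∩ S) ∧
      -x ∈ Metric.thickening δ (F i ∩ S)) := fun i =>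
    LS.exists_delta _ ((isCompact_sphere _ _).inter_left (hF i))
      fun x hx h => hcon i x hx.2 hx.1 h.1
  choose δ hδ hδ2 using hd
  let s : ℕ → LS.V n → ZMod 2 := fun i => if h : i < n + 1 then LS.sgn (δ ⟨i, h⟩) (F ⟨i, h⟩ ∩ S)
    else LS.sgn 1 ∅
  have hs : ∀ i x, ‖x‖ = 1 → s i (-x) = s i x + 1 := by
    intro i x hx
    simp only [s]
    split_ifs with h
    · exact LS.sgn_neg _ _ _ hx (hδ2 _ x)
    · exact LS.sgn_neg _ _ _ hx (by simp)
  obtain ⟨ε, hε, hεδ⟩ : ∃ ε > 0, ∀ i, ε ≤ δ i := by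
    obtain ⟨i, hi⟩ := Finite.exists_min δ
    exact ⟨δ i, hδ i, hi⟩
  obtain ⟨N, hN⟩ := exists_nat_gt (n * Real.pi / ε)
  have hN0 : (0 : ℝ) < N := lt_of_le_of_lt (by positivity) hN
  have hsm : n * (Real.pi / N) < ε := by
    rw [div_lt_iff₀ hε] at hN
    rw [← mul_div_assoc, div_lt_iff₀ hN0]
    linarith
  obtain ⟨z, hz, -, hw⟩ := LS.exists_chain s hs N (by exact_mod_cast hN0) n le_rfl
  have : LS.W s n z = (0 : LS.Ch (LS.V n) →ₗ[ZMod 2] ZMod 2) z := by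
    refine LS.fun_eq hz fun l hl => ?_
    rw [LinearMap.zero_apply]
    rcases l with _ | ⟨v, l⟩
    · exact LS.W_nil s n
    have hv := (hl.1 v (by simp)).1
    have hvS : v ∈ S := by simpa [hS] using hv
    have hvS' : -v ∈ S := by simpa [hS] using hv
    have hcl : ∀ x ∈ v :: l, dist x v < ε := fun x hx => (hl.2 x hx v (by simp)).trans_lt hsm
    obtain ⟨j, hj, hjv⟩ : ∃ j : Fin (n + 1), j.val < n ∧ (v ∈ F j ∨ -v ∈ F j) := by
      obtain ⟨i, hi⟩ := Set.mem_iUnion.1 (hcover hvS)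
      obtain ⟨i', hi'⟩ := Set.mem_iUnion.1 (hcover hvS')
      by_cases h1 : i.val < n
      · exact ⟨i, h1, Or.inl hi⟩
      by_cases h2 : i'.val < n
      · exact ⟨i', h2, Or.inr hi'⟩
      have : i = i' := by ext; omega
      subst this
      exact absurd hi' (hcon i v hvS hi)
    apply LS.W_vanish s j.val n hj
    have hsj : s j.val = LS.sgn (δ j) (F j ∩ S) := by
      simp only [s]
      rw [dif_pos j.2]
    rw [hsj]
    suffices ∃ c, ∀ x ∈ v :: l, LS.sgn (δ j) (F j ∩ S) x = c by
      obtain ⟨c, hc⟩ := this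
      intro x hx y hy
      rw [hc x hx, hc y hy]
    rcases hjv with hjv | hjv
    · refine ⟨1, fun x hx => ?_⟩
      have : x ∈ Metric.thickening (δ j) (F j ∩ S) :=
        Metric.mem_thickening_iff.2 ⟨v, ⟨hjv, hvS⟩, (hcl x hx).trans_le (hεδ j)⟩
      simp [LS.sgn, this]
    · refine ⟨0, fun x hx => ?_⟩
      have h1 : -x ∈ Metric.thickening (δ j) (F j ∩ S) :=
        Metric.mem_thickening_iff.2 ⟨-v, ⟨hjv, hvS'⟩, by
          rw [dist_neg_neg]; exact (hcl x hx).trans_le (hεδ j)⟩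
      have h2 : x ∉ Metric.thickening (δ j) (F j ∩ S) := fun h => hδ2 j x ⟨h, h1⟩
      simp [LS.sgn, h1, h2]
  rw [hw] at this
  simp at this
end
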